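/- arXiv:1401.5927 — 2 statements merged into one kernel-verified Lean document; each statement's English description precedes it below -/
import Mathlib

section
/- Let S_λ be a contractive weighted shift with strictly positive weights on a directed tree 𝒯 = (V, E), and let α_u be the eigenvalues of its asymptotic limit A (A e_u = α_u e_u). Then S_λ is similar to an isometry (i.e., there exists a bounded invertible operator X on ℓ²(V) such that X S_λ X⁻¹ is an isometry) if and only if inf{α_u : u ∈ V} > 0. -/
open Filter Topology

/-- `E` is the edge relation of a directed tree on the vertex set `V`:
no loops, every vertex has at most one parent, the underlying undirected graph is
connected (any two distinct vertices are joined by a finite undirected path), and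
there is no directed circuit. -/
def IsDirectedTree {V : Type*} (E : V → V → Prop) : Prop :=
  (∀ v, ¬ E v v) ∧
  (∀ u u' v, E u v → E u' v → u = u') ∧
  (∀ u v : V, Relation.ReflTransGen (fun a b => E a b ∨ E b a) u v) ∧
  (∀ (n : ℕ) (f : Fin (n + 2) → V), Function.Injective f →
    ¬ ((∀ i : Fin (n + 1), E (f i.castSucc) (f i.succ)) ∧ E (f (Fin.last (n + 1))) (f 0)))

/-- The set `Chi(W)` of children of the vertices in `W`; its `n`-th iterate applied to `{u}`
is `Chiⁿ(u)`. -/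
def chi {V : Type*} (E : V → V → Prop) (W : Set V) : Set V :=
  {v | ∃ u ∈ W, E u v}

/-- The parent `Par(v)` of a vertex `v` (by convention `v` itself if `v` has no parent). -/
noncomputable def par {V : Type*} (E : V → V → Prop) (v : V) : V :=
  haveI := Classical.propDecidable (∃ u, E u v)
  if h : ∃ u, E u v then h.choose else v

/-- `Parⁿ(u)` exists, i.e. the whole ancestor chain of length `n` above `u` exists. -/
def parIterExists {V : Type*} (E : V → V → Prop) (n : ℕ) (u : V) : Prop :=
  ∀ j < n, ∃ w, E w ((par E)^[j] u)

/-- The level (whole generation) `Gen(u) = ⋃_j Chi^j(Par^j(u))` of a vertex `u`. -/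
def gen {V : Type*} (E : V → V → Prop) (u : V) : Set V :=
  ⋃ j : ℕ, (chi E)^[j] {(par E)^[j] u}

/-- The standard orthonormal basis vector `e_u` of `ℓ²(V)`. -/
noncomputable def evec {V : Type*} (u : V) : lp (fun _ : V => ℂ) 2 :=
  haveI := Classical.decEq V
  lp.single 2 u 1

open scoped InnerProductSpace

section AsymptoticLimit

variable {H : Type*} [NormedAddCommGroup H] [InnerProductSpace ℂ H] [CompleteSpace H]

theorem tendsto_inner_pow_asymptoticLimit {S A : H →L[ℂ] H}
    (hA : ∀ x, Tendsto (fun n : ℕ => ((ContinuousLinearMap.adjoint S) ^ n) ((S ^ n) x))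
      atTop (𝓝 (A x))) (x y : H) :
    Tendsto (fun n : ℕ => ⟪(S ^ n) x, (S ^ n) y⟫_ℂ) atTop (𝓝 ⟪A x, y⟫_ℂ) := by
  refine ((hA x).inner tendsto_const_nhds).congr fun n => ?_
  have h : (ContinuousLinearMap.adjoint S) ^ n = ContinuousLinearMap.adjoint (S ^ n) := by
    simp only [← ContinuousLinearMap.star_eq_adjoint, star_pow]
  rw [h, ContinuousLinearMap.adjoint_inner_left]

theorem tendsto_norm_sq_pow_asymptoticLimit {S A : H →L[ℂ] H}
    (hA : ∀ x, Tendsto (fun n : ℕ => ((ContinuousLinearMap.adjoint S) ^ n) ((S ^ n) x))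
      atTop (𝓝 (A x))) (x : H) :
    Tendsto (fun n : ℕ => ‖(S ^ n) x‖ ^ 2) atTop (𝓝 (RCLike.re ⟪A x, x⟫_ℂ)) := by
  refine (((RCLike.continuous_re (K := ℂ)).tendsto _).comp
    (tendsto_inner_pow_asymptoticLimit hA x x)).congr fun n => ?_
  exact inner_self_eq_norm_sq (𝕜 := ℂ) _

theorem isSymmetric_asymptoticLimit {S A : H →L[ℂ] H}
    (hA : ∀ x, Tendsto (fun n : ℕ => ((ContinuousLinearMap.adjoint S) ^ n) ((S ^ n) x))
      atTop (𝓝 (A x))) : (A : H →ₗ[ℂ] H).IsSymmetric := by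
  intro x y
  have h := (RCLike.continuous_conj (K := ℂ)).tendsto _ |>.comp
    (tendsto_inner_pow_asymptoticLimit hA y x)
  refine tendsto_nhds_unique (tendsto_inner_pow_asymptoticLimit hA x y)
    ((h.congr fun n => inner_conj_symm _ _).trans_eq ?_)
  exact congrArg 𝓝 (inner_conj_symm _ _)

theorem re_inner_asymptoticLimit_apply_self {S A : H →L[ℂ] H}
    (hA : ∀ x, Tendsto (fun n : ℕ => ((ContinuousLinearMap.adjoint S) ^ n) ((S ^ n) x))
      atTop (𝓝 (A x))) (x : H) :
    RCLike.re ⟪A (S x), S x⟫_ℂ = RCLike.re ⟪A x, x⟫_ℂ := by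
  refine tendsto_nhds_unique (tendsto_norm_sq_pow_asymptoticLimit hA (S x))
    (((tendsto_add_atTop_iff_nat 1).2 (tendsto_norm_sq_pow_asymptoticLimit hA x)).congr
      fun n => ?_)
  rw [pow_succ]
  rfl

/-- An operator similar to an isometry has an asymptotic limit bounded below. -/
theorem exists_pos_mul_norm_sq_le_of_similar_isometry {S A : H →L[ℂ] H}
    (hA : ∀ x, Tendsto (fun n : ℕ => ((ContinuousLinearMap.adjoint S) ^ n) ((S ^ n) x))
      atTop (𝓝 (A x))) (X : H ≃L[ℂ] H) (hX : ∀ x, ‖X (S (X.symm x))‖ = ‖x‖) :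
    ∃ c : ℝ, 0 < c ∧ ∀ x, c * ‖x‖ ^ 2 ≤ RCLike.re ⟪A x, x⟫_ℂ := by
  obtain ⟨K, hK, hXK⟩ := (X : H →L[ℂ] H).bound
  obtain ⟨L, hL, hXL⟩ := (X.symm : H →L[ℂ] H).bound
  have hpow : ∀ (n : ℕ) (x : H), ‖X ((S ^ n) x)‖ = ‖X x‖ := by
    intro n
    induction n with
    | zero => simp
    | succ n ih =>
      intro x
      have h := hX (X x)
      rw [X.symm_apply_apply] at h
      rw [pow_succ, mul_apply_eq_comp, ih, h]
  refine ⟨((L * K) ^ 2)⁻¹, by positivity, fun x => ?_⟩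
  refine ge_of_tendsto' (tendsto_norm_sq_pow_asymptoticLimit hA x) fun n => ?_
  have h : ‖x‖ ≤ L * K * ‖(S ^ n) x‖ := by
    calc ‖x‖ ≤ L * ‖X x‖ := by simpa using hXL (X x)
      _ = L * ‖X ((S ^ n) x)‖ := by rw [hpow]
      _ ≤ L * (K * ‖(S ^ n) x‖) := by gcongr; exact hXK _
      _ = L * K * ‖(S ^ n) x‖ := by ring
  rw [inv_mul_le_iff₀ (by positivity), ← mul_pow]
  gcongr

/-- An operator whose asymptotic limit is bounded below is similar to an isometry. -/
theorem exists_similar_isometry_of_mul_norm_sq_le {S A : H →L[ℂ] H}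
    (hA : ∀ x, Tendsto (fun n : ℕ => ((ContinuousLinearMap.adjoint S) ^ n) ((S ^ n) x))
      atTop (𝓝 (A x))) {c : ℝ} (hc : 0 < c)
    (h : ∀ x, c * ‖x‖ ^ 2 ≤ RCLike.re ⟪A x, x⟫_ℂ) :
    ∃ X : H ≃L[ℂ] H, ∀ x, ‖X (S (X.symm x))‖ = ‖x‖ := by
  have hc1 : IsStrictlyPositive (algebraMap ℝ (H →L[ℂ] H) c) := by
    rcases subsingleton_or_nontrivial (H →L[ℂ] H) with _ | _
    · exact ⟨(Subsingleton.elim _ _).le, isUnit_of_subsingleton _⟩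
    · exact ⟨algebraMap_nonneg _ hc.le, (IsUnit.mk0 c hc.ne').map (algebraMap ℝ _)⟩
  have hcx : ∀ x : H, algebraMap ℝ (H →L[ℂ] H) c x = (c : ℂ) • x := by
    intro x
    simp [Algebra.algebraMap_eq_smul_one]
  have hle : algebraMap ℝ (H →L[ℂ] H) c ≤ A := by
    rw [ContinuousLinearMap.le_def]
    refine ⟨(isSymmetric_asymptoticLimit hA).sub fun x y => ?_, fun x => ?_⟩
    · simp only [ContinuousLinearMap.coe_coe, hcx, inner_smul_left, inner_smul_right,
        Complex.conj_ofReal]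
    · have h2 : RCLike.re ((c : ℂ) * ((‖x‖ : ℂ) ^ 2)) = c * ‖x‖ ^ 2 := by
        rw [← Complex.ofReal_pow, ← Complex.ofReal_mul]
        exact Complex.ofReal_re _
      rw [ContinuousLinearMap.reApplyInnerSelf_apply, sub_apply, hcx, inner_sub_left,
        inner_smul_left, Complex.conj_ofReal, inner_self_eq_norm_sq_to_K, map_sub]
      exact sub_nonneg.2 (h2.trans_le (h x))
  have hA0 : 0 ≤ A := hc1.nonneg.trans hle
  have hAu : IsUnit A := CStarAlgebra.isUnit_of_le _ hle hc1
  have hXX : CFC.sqrt A * CFC.sqrt A = A := CFC.sqrt_mul_sqrt_self A hA0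
  have hXu : IsUnit (CFC.sqrt A) := (CFC.isUnit_sqrt_iff A hA0).2 hAu
  have hXs : IsSelfAdjoint (CFC.sqrt A) := (CFC.sqrt_nonneg A).isSelfAdjoint
  have hnorm : ∀ x, ‖CFC.sqrt A x‖ ^ 2 = RCLike.re ⟪A x, x⟫_ℂ := by
    intro x
    rw [← inner_self_eq_norm_sq (𝕜 := ℂ)]
    conv_rhs => rw [← hXX, mul_apply_eq_comp]
    exact congrArg _ (hXs.isSymmetric (CFC.sqrt A x) x).symm
  refine ⟨ContinuousLinearEquiv.ofUnit hXu.unit, fun x => ?_⟩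
  have key : ∀ y, ‖CFC.sqrt A (S y)‖ = ‖CFC.sqrt A y‖ := by
    intro y
    rw [← sq_eq_sq₀ (norm_nonneg _) (norm_nonneg _), hnorm, hnorm,
      re_inner_asymptoticLimit_apply_self hA]
  refine (key _).trans ?_
  exact congrArg norm ((ContinuousLinearEquiv.ofUnit hXu.unit).apply_symm_apply x)

end AsymptoticLimit

theorem inner_evec_left {V : Type*} (u : V) (x : lp (fun _ : V => ℂ) 2) :
    ⟪evec u, x⟫_ℂ = x u := by
  classical
  have h := lp.inner_single_left (𝕜 := ℂ) (G := fun _ : V => ℂ) u 1 x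
  simp only [RCLike.inner_apply, map_one, mul_one] at h
  rw [← h, evec]

theorem norm_evec {V : Type*} (u : V) : ‖evec u‖ = 1 := by
  classical
  simp [evec, lp.norm_single]

theorem apply_eq_mul_of_apply_evec {V : Type*}
    {A : lp (fun _ : V => ℂ) 2 →L[ℂ] lp (fun _ : V => ℂ) 2}
    (hA : (A : lp (fun _ : V => ℂ) 2 →ₗ[ℂ] lp (fun _ : V => ℂ) 2).IsSymmetric)
    {alpha : V → ℝ} (halpha : ∀ u : V, A (evec u) = ((alpha u : ℝ) : ℂ) • evec u)
    (x : lp (fun _ : V => ℂ) 2) (u : V) : A x u = alpha u * x u := by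
  have h := hA (evec u) x
  simp only [ContinuousLinearMap.coe_coe] at h
  rw [inner_evec_left, halpha, inner_smul_left, inner_evec_left, Complex.conj_ofReal] at h
  exact h.symm

theorem mul_norm_sq_le_re_inner_of_apply_evec {V : Type*}
    {A : lp (fun _ : V => ℂ) 2 →L[ℂ] lp (fun _ : V => ℂ) 2}
    (hA : (A : lp (fun _ : V => ℂ) 2 →ₗ[ℂ] lp (fun _ : V => ℂ) 2).IsSymmetric)
    {alpha : V → ℝ} (halpha : ∀ u : V, A (evec u) = ((alpha u : ℝ) : ℂ) • evec u)
    {c : ℝ} (hc : ∀ u, c ≤ alpha u) (x : lp (fun _ : V => ℂ) 2) :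
    c * ‖x‖ ^ 2 ≤ RCLike.re ⟪A x, x⟫_ℂ := by
  have h1 := (RCLike.hasSum_re ℂ (lp.hasSum_inner (𝕜 := ℂ) x x)).mul_left c
  rw [inner_self_eq_norm_sq] at h1
  refine hasSum_le (fun u => ?_) h1 (RCLike.hasSum_re ℂ (lp.hasSum_inner (𝕜 := ℂ) (A x) x))
  rw [inner_self_eq_norm_sq, apply_eq_mul_of_apply_evec hA halpha]
  have h2 : RCLike.re ⟪(alpha u : ℂ) * x u, x u⟫_ℂ = alpha u * ‖x u‖ ^ 2 := by
    rw [← smul_eq_mul, inner_smul_left, Complex.conj_ofReal, inner_self_eq_norm_sq_to_K]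
    exact Complex.re_ofReal_mul (alpha u) _ |>.trans (by norm_cast)
  rw [h2]
  gcongr
  exact hc u

/-- A contractive weighted shift on a directed tree is similar to an isometry if and only if
`inf {α_u : u ∈ V} > 0`, where `α_u` are the diagonal entries of its asymptotic limit `A`. -/
theorem stmt_11 {V : Type*} [Nonempty V] (E : V → V → Prop) (hE : IsDirectedTree E)
    (lam : V → ℝ) (hlam : ∀ v, (∃ u, E u v) → 0 < lam v)
    (S : lp (fun _ : V => ℂ) 2 →L[ℂ] lp (fun _ : V => ℂ) 2)
    (hS : ∀ u v : V, (S (evec u)) v = Set.indicator {w | E u w} (fun w => (lam w : ℂ)) v)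
    (hcon : ‖S‖ ≤ 1)
    (A : lp (fun _ : V => ℂ) 2 →L[ℂ] lp (fun _ : V => ℂ) 2)
    (hA : ∀ x, Tendsto (fun n : ℕ => ((ContinuousLinearMap.adjoint S) ^ n) ((S ^ n) x))
      atTop (𝓝 (A x)))
    (alpha : V → ℝ) (halpha : ∀ u : V, A (evec u) = ((alpha u : ℝ) : ℂ) • evec u) :
    (∃ X : lp (fun _ : V => ℂ) 2 ≃L[ℂ] lp (fun _ : V => ℂ) 2,
      ∀ x : lp (fun _ : V => ℂ) 2, ‖X (S (X.symm x))‖ = ‖x‖) ↔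
    0 < ⨅ u : V, alpha u := by
  constructor
  · rintro ⟨X, hX⟩
    obtain ⟨c, hc, h⟩ := exists_pos_mul_norm_sq_le_of_similar_isometry hA X hX
    refine hc.trans_le (le_ciInf fun u => ?_)
    have hu := h (evec u)
    rw [halpha, inner_smul_left, inner_self_eq_norm_sq_to_K, norm_evec] at hu
    simpa using hu
  · intro hpos
    have hbdd : BddBelow (Set.range alpha) := by
      by_contra hb
      exact hpos.ne' (Real.iInf_of_not_bddBelow hb)
    exact exists_similar_isometry_of_mul_norm_sq_le hA hpos
      (mul_norm_sq_le_re_inner_of_apply_evec (isSymmetric_asymptoticLimit hA) halpha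
        fun u => ciInf_le hbdd u)
end

section
/- Let 𝒯 = (V, E) be a directed tree with no root, with branching index Br(𝒯) = 1, and with exactly two leaves. Then every bounded weighted shift S_λ with strictly positive weights on 𝒯 is cyclic. -/
open Filter Topology

/-- `f` is a cyclic vector for the bounded linear operator `T`: the closed linear span of the
orbit `{Tⁿ f : n ∈ ℤ₊}` is the whole space. -/
def IsCyclicVector {H : Type*} [NormedAddCommGroup H] [NormedSpace ℂ H]
    (T : H →L[ℂ] H) (f : H) : Prop :=
  (Submodule.span ℂ (Set.range fun n : ℕ => (T ^ n) f)).topologicalClosure = ⊤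

section BackwardOrbit

variable {H : Type*} [NormedAddCommGroup H]

/-- A positive sequence that decreases so fast that the terms `backwardWeight e (n + k + 1)`
are negligible against `backwardWeight e n`, even after multiplication by `‖e (j + k + 1)‖`. -/
noncomputable def backwardWeight (e : ℕ → H) (n : ℕ) : ℝ :=
  ∏ i ∈ Finset.range n, ((1 / 2) ^ (i + 1) * (1 + ∑ l ∈ Finset.range (i + 2), ‖e l‖)⁻¹)

theorem one_le_one_add_sum_norm (e : ℕ → H) (n : ℕ) :
    1 ≤ 1 + ∑ l ∈ Finset.range n, ‖e l‖ :=
  le_add_of_nonneg_right (Finset.sum_nonneg fun _ _ => norm_nonneg _)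

theorem backwardWeight_succ (e : ℕ → H) (n : ℕ) :
    backwardWeight e (n + 1) = backwardWeight e n *
      ((1 / 2) ^ (n + 1) * (1 + ∑ l ∈ Finset.range (n + 2), ‖e l‖)⁻¹) :=
  Finset.prod_range_succ _ _

theorem backwardWeight_pos (e : ℕ → H) (n : ℕ) : 0 < backwardWeight e n :=
  Finset.prod_pos fun i _ => mul_pos (by positivity)
    (inv_pos.2 (zero_lt_one.trans_le (one_le_one_add_sum_norm e _)))

theorem backwardWeight_antitone (e : ℕ → H) : Antitone (backwardWeight e) := by
  refine antitone_nat_of_succ_le fun n => ?_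
  rw [backwardWeight_succ]
  refine mul_le_of_le_one_right (backwardWeight_pos e n).le (mul_le_one₀ ?_ ?_ ?_)
  · exact pow_le_one₀ (by norm_num) (by norm_num)
  · exact inv_nonneg.2 (zero_le_one.trans (one_le_one_add_sum_norm e _))
  · exact inv_le_one_of_one_le₀ (one_le_one_add_sum_norm e _)

theorem backwardWeight_mul_norm_le (e : ℕ → H) {j n : ℕ} (hj : j ≤ n) (k : ℕ) :
    backwardWeight e (n + k + 1) * ‖e (j + k + 1)‖ ≤
      backwardWeight e n * (1 / 2) ^ (n + k + 1) := by
  have hM := zero_lt_one.trans_le (one_le_one_add_sum_norm e (n + k + 2))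
  have hnorm : ‖e (j + k + 1)‖ ≤ 1 + ∑ l ∈ Finset.range (n + k + 2), ‖e l‖ :=
    (Finset.single_le_sum (f := fun l => ‖e l‖) (fun _ _ => norm_nonneg _)
      (Finset.mem_range.2 (by omega))).trans (le_add_of_nonneg_left zero_le_one)
  have hanti : backwardWeight e (n + k) ≤ backwardWeight e n :=
    backwardWeight_antitone e (Nat.le_add_right _ _)
  have hn := backwardWeight_pos e n
  calc backwardWeight e (n + k + 1) * ‖e (j + k + 1)‖
      ≤ backwardWeight e (n + k + 1) * (1 + ∑ l ∈ Finset.range (n + k + 2), ‖e l‖) :=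
        mul_le_mul_of_nonneg_left hnorm (backwardWeight_pos e _).le
    _ = backwardWeight e (n + k) * (1 / 2) ^ (n + k + 1) := by
        rw [backwardWeight_succ]
        field_simp
    _ ≤ _ := by gcongr

variable [NormedSpace ℂ H] [CompleteSpace H]

theorem summable_backwardWeight_smul (e : ℕ → H) (m : ℕ) :
    Summable fun k => (backwardWeight e (k + m) : ℂ) • e k := by
  rw [← summable_nat_add_iff 1]
  refine Summable.of_norm_bounded (g := fun k => backwardWeight e m * (1 / 2) ^ (m + 1) *
    (1 / 2) ^ k) (summable_geometric_two.mul_left _) fun k => ?_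
  have h := backwardWeight_mul_norm_le e (Nat.zero_le m) k
  rw [norm_smul, Complex.norm_real, Real.norm_of_nonneg (backwardWeight_pos e _).le,
    show k + 1 + m = m + k + 1 by omega]
  rw [zero_add] at h
  exact h.trans_eq (by ring)

theorem pow_apply_tsum_backwardWeight (T : H →L[ℂ] H) {e : ℕ → H} (h0 : T (e 0) = 0)
    (hs : ∀ n, T (e (n + 1)) = e n) (m : ℕ) :
    (T ^ m) (∑' k, (backwardWeight e k : ℂ) • e k) =
      ∑' k, (backwardWeight e (k + m) : ℂ) • e k := by
  induction m with
  | zero => simp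
  | succ m ih =>
    rw [pow_succ', mul_apply_eq_comp, ih,
      T.map_tsum (summable_backwardWeight_smul e m),
      (T.summable (summable_backwardWeight_smul e m)).tsum_eq_zero_add]
    simp only [map_smul, h0, hs, smul_zero, zero_add]
    exact tsum_congr fun k => by rw [show k + 1 + m = k + (m + 1) by omega]

theorem mem_of_eventually_tsum_backwardWeight_mem (e : ℕ → H) (M : Submodule ℂ H)
    (hM : IsClosed (M : Set H)) (p : ℕ)
    (hp : ∀ m, p ≤ m → ∑' k, (backwardWeight e (k + m) : ℂ) • e k ∈ M) (j : ℕ) :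
    e j ∈ M := by
  induction j using Nat.strong_induction_on with
  | _ j ih =>
    set y : ℕ → H := fun m => (backwardWeight e (j + m) : ℂ)⁻¹ •
      (∑' k, (backwardWeight e (k + m) : ℂ) • e k -
        ∑ k ∈ Finset.range j, (backwardWeight e (k + m) : ℂ) • e k) with hy
    have hyM : ∀ᶠ m in atTop, y m ∈ (M : Set H) := by
      filter_upwards [eventually_ge_atTop p] with m hm
      exact M.smul_mem _ (M.sub_mem (hp m hm) (M.sum_mem fun k hk =>
        M.smul_mem _ (ih k (Finset.mem_range.1 hk))))
    refine hM.mem_of_tendsto ?_ hyM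
    rw [tendsto_iff_norm_sub_tendsto_zero]
    refine squeeze_zero (fun _ => norm_nonneg _) (g := fun m => (1 / 2 : ℝ) ^ m) (fun m => ?_)
      (tendsto_pow_atTop_nhds_zero_of_lt_one (by norm_num) (by norm_num))
    have hsum := summable_backwardWeight_smul e m
    have hpos := backwardWeight_pos e (j + m)
    have hne : (backwardWeight e (j + m) : ℂ) ≠ 0 := by exact_mod_cast hpos.ne'
    have hsplit : y m - e j = (backwardWeight e (j + m) : ℂ)⁻¹ •
        ∑' k, (backwardWeight e (j + m + k + 1) : ℂ) • e (j + k + 1) := by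
      have h2 := ((summable_nat_add_iff j).2 hsum).tsum_eq_zero_add
      simp only [hy]
      rw [← hsum.sum_add_tsum_nat_add j, add_sub_cancel_left, h2, smul_add, zero_add,
        smul_smul, inv_mul_cancel₀ hne, one_smul, add_sub_cancel_left]
      congr 1
      exact tsum_congr fun k => by
        rw [show k + 1 + j + m = j + m + k + 1 by omega, show k + 1 + j = j + k + 1 by omega]
    rw [hsplit, norm_smul, norm_inv, Complex.norm_real, Real.norm_of_nonneg hpos.le,
      inv_mul_le_iff₀ hpos]
    have hgeom : HasSum (fun k : ℕ => backwardWeight e (j + m) * (1 / 2) ^ (j + m + 1) *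
        (1 / 2 : ℝ) ^ k) (backwardWeight e (j + m) * (1 / 2) ^ (j + m + 1) * 2) :=
      hasSum_geometric_two.mul_left _
    refine (tsum_of_norm_bounded hgeom fun k => ?_).trans ?_
    · rw [norm_smul, Complex.norm_real, Real.norm_of_nonneg (backwardWeight_pos e _).le]
      calc _ ≤ _ := backwardWeight_mul_norm_le e (Nat.le_add_right j m) k
        _ = _ := by ring
    · rw [pow_succ, mul_assoc, mul_assoc]
      refine mul_le_mul_of_nonneg_left ?_ hpos.le
      calc ((1 : ℝ) / 2) ^ (j + m) * (1 / 2 * 2) = (1 / 2) ^ (j + m) := by ring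
        _ ≤ _ := pow_le_pow_of_le_one (by norm_num) (by norm_num) (Nat.le_add_left m j)

/-- If `T` acts as a backward shift along `e` and `g` is annihilated by a power of `T`, then
some orbit of `T` has a closed linear span containing all `e n` and `g`. -/
theorem exists_orbit_closedSpan_mem (T : H →L[ℂ] H) {e : ℕ → H} (h0 : T (e 0) = 0)
    (hs : ∀ n, T (e (n + 1)) = e n) {g : H} {p : ℕ} (hg : (T ^ p) g = 0) :
    ∃ f, ∀ M : Submodule ℂ H, IsClosed (M : Set H) → (∀ n, (T ^ n) f ∈ M) →
      (∀ n, e n ∈ M) ∧ g ∈ M := by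
  refine ⟨∑' k, (backwardWeight e k : ℂ) • e k + g, fun M hM hf => ?_⟩
  have he : ∀ n, e n ∈ M := mem_of_eventually_tsum_backwardWeight_mem e M hM p fun m hm => by
    have h := hf m
    obtain ⟨k, rfl⟩ := Nat.exists_eq_add_of_le' hm
    rwa [map_add, pow_apply_tsum_backwardWeight T h0 hs, pow_add T k p,
      mul_apply_eq_comp, hg, map_zero, add_zero] at h
  refine ⟨he, ?_⟩
  have h0M : ∑' k, (backwardWeight e k : ℂ) • e k ∈ M :=
    hM.mem_of_tendsto (summable_backwardWeight_smul e 0).hasSum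
      (Eventually.of_forall fun s => M.sum_mem fun k _ => M.smul_mem _ (he k))
  simpa using M.sub_mem (hf 0) h0M

end BackwardOrbit

section BasisVectors

variable {V : Type*}

theorem evec_apply [DecidableEq V] (u v : V) : (evec u) v = if v = u then 1 else 0 := by
  unfold evec
  rw [@lp.single_apply _ _ _ (Classical.decEq V)]
  by_cases h : v = u
  · subst h; simp
  · simp [h]

theorem eq_top_of_forall_evec_mem (M : Submodule ℂ (lp (fun _ : V => ℂ) 2))
    (hM : IsClosed (M : Set (lp (fun _ : V => ℂ) 2))) (h : ∀ v, evec v ∈ M) : M = ⊤ := by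
  classical
  refine eq_top_iff.2 fun f _ => hM.mem_of_tendsto (lp.hasSum_single (by norm_num) f)
    (Eventually.of_forall fun s => M.sum_mem fun v _ => ?_)
  have hv : lp.single 2 v (f v) = f v • evec v := by
    ext w
    rw [lp.coeFn_smul, Pi.smul_apply, evec_apply, lp.single_apply]
    by_cases hw : w = v
    · subst hw; simp
    · simp [hw]
  rw [hv]
  exact M.smul_mem _ (h v)

end BasisVectors

section Shift

variable {V : Type*} {E : V → V → Prop} {lam : V → ℝ}
  {S : lp (fun _ : V => ℂ) 2 →L[ℂ] lp (fun _ : V => ℂ) 2}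

theorem shift_evec_of_leaf
    (hS : ∀ u v : V, (S (evec u)) v = Set.indicator {w | E u w} (fun w => (lam w : ℂ)) v)
    {u : V} (hu : ∀ w, ¬ E u w) : S (evec u) = 0 := by
  ext v
  rw [hS, Set.indicator_of_notMem fun h : v ∈ {w | E u w} => hu v h]
  rfl

theorem shift_evec_of_unique_child
    (hS : ∀ u v : V, (S (evec u)) v = Set.indicator {w | E u w} (fun w => (lam w : ℂ)) v)
    {u v : V} (huv : E u v) (hu : {w | E u w}.Subsingleton) :
    S (evec u) = (lam v : ℂ) • evec v := by
  classical
  ext w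
  rw [hS, lp.coeFn_smul, Pi.smul_apply, evec_apply]
  by_cases hw : w = v
  · subst hw
    rw [Set.indicator_of_mem (show w ∈ {w | E u w} from huv)]
    simp
  · rw [Set.indicator_of_notMem fun h => hw (hu h huv)]
    simp [hw]

theorem shift_evec_of_two_children
    (hS : ∀ u v : V, (S (evec u)) v = Set.indicator {w | E u w} (fun w => (lam w : ℂ)) v)
    {u a b : V} (hab : a ≠ b) (hu : {w | E u w} = {a, b}) :
    S (evec u) = (lam a : ℂ) • evec a + (lam b : ℂ) • evec b := by
  classical
  ext w
  rw [hS, hu, lp.coeFn_add, Pi.add_apply, lp.coeFn_smul, Pi.smul_apply, evec_apply,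
    lp.coeFn_smul, Pi.smul_apply, evec_apply]
  by_cases hwa : w = a
  · subst hwa; simp [hab]
  · by_cases hwb : w = b
    · subst hwb; simp [hwa]
    · simp [hwa, hwb]

end Shift

section Tree

variable {V : Type*} {E : V → V → Prop}

theorem par_edge (hrootless : ∀ v : V, ∃ u, E u v) (v : V) : E (par E v) v := by
  unfold par
  rw [dif_pos (hrootless v)]
  exact (hrootless v).choose_spec

theorem par_eq_of_edge (hE : IsDirectedTree E) (hrootless : ∀ v : V, ∃ u, E u v) {u v : V}
    (h : E u v) : par E v = u :=
  hE.2.1 _ _ _ (par_edge hrootless v) h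

theorem par_iterate_edge (hrootless : ∀ v : V, ∃ u, E u v) (n : ℕ) (v : V) :
    E ((par E)^[n + 1] v) ((par E)^[n] v) := by
  rw [Function.iterate_succ_apply']
  exact par_edge hrootless _

theorem par_iterate_ne_self (hE : IsDirectedTree E) (hrootless : ∀ v : V, ∃ u, E u v) (v : V)
    (n : ℕ) : (par E)^[n + 1] v ≠ v := by
  intro hn
  classical
  have hex : ∃ n, (par E)^[n + 1] v = v := ⟨n, hn⟩
  obtain ⟨m, hm, hmin⟩ : ∃ m, (par E)^[m + 1] v = v ∧ ∀ k < m, (par E)^[k + 1] v ≠ v :=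
    ⟨Nat.find hex, Nat.find_spec hex, fun k hk => Nat.find_min hex hk⟩
  have hinj : ∀ i j, i < j → j ≤ m → (par E)^[i] v ≠ (par E)^[j] v := by
    intro i j hij hj h
    have h' := congrArg (par E)^[m + 1 - j] h
    rw [← Function.iterate_add_apply, ← Function.iterate_add_apply,
      Nat.sub_add_cancel (by omega), hm] at h'
    refine hmin (m - j + i) (by omega) ?_
    rwa [show m - j + i + 1 = m + 1 - j + i by omega]
  cases m with
  | zero =>
    have h := par_edge hrootless v
    rw [show par E v = v from hm] at h
    exact hE.1 v h
  | succ m =>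
    refine hE.2.2.2 m (fun i => (par E)^[m + 1 - i] v) ?_ ⟨fun i => ?_, ?_⟩
    · intro i j hij
      by_contra hne
      have hne' : (i : ℕ) ≠ j := fun h => hne (Fin.ext h)
      rcases lt_or_gt_of_ne hne' with h | h
      · exact hinj (m + 1 - j) (m + 1 - i) (by omega) (by omega) hij.symm
      · exact hinj (m + 1 - i) (m + 1 - j) (by omega) (by omega) hij
    · have h := par_iterate_edge hrootless (m - i) v
      simpa only [Fin.val_castSucc, Fin.val_succ, Nat.add_sub_add_right,
        show m + 1 - (i : ℕ) = m - i + 1 by omega] using h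
    · have h := par_iterate_edge hrootless (m + 1) v
      rw [hm] at h
      simpa using h

theorem exists_par_iterate_of_reflTransGen (hE : IsDirectedTree E)
    (hrootless : ∀ v : V, ∃ u, E u v) {u v : V} (h : Relation.ReflTransGen E u v) :
    ∃ n, (par E)^[n] v = u := by
  induction h with
  | refl => exact ⟨0, rfl⟩
  | tail _ hbc ih =>
    obtain ⟨n, hn⟩ := ih
    exact ⟨n + 1, by rw [Function.iterate_succ_apply, par_eq_of_edge hE hrootless hbc, hn]⟩

theorem not_reflTransGen_of_edge (hE : IsDirectedTree E) (hrootless : ∀ v : V, ∃ u, E u v)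
    {u v : V} (huv : E u v) : ¬ Relation.ReflTransGen E v u := by
  intro h
  obtain ⟨n, hn⟩ := exists_par_iterate_of_reflTransGen hE hrootless h
  refine par_iterate_ne_self hE hrootless u n ?_
  rw [Function.iterate_succ_apply', hn, par_eq_of_edge hE hrootless huv]

theorem par_iterate_or_reflTransGen (hE : IsDirectedTree E) (hrootless : ∀ v : V, ∃ u, E u v)
    {u₀ : V} (hu₀ : ∀ u, u ≠ u₀ → {v | E u v}.Subsingleton) (v : V) :
    (∃ n, v = (par E)^[n] u₀) ∨ Relation.ReflTransGen E u₀ v := by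
  induction hE.2.2.1 u₀ v with
  | refl => exact Or.inr .refl
  | @tail x y _ hxy ih =>
    rcases hxy with hxy | hyx
    · rcases ih with ⟨_ | n, rfl⟩ | h
      · exact Or.inr (.single hxy)
      · exact Or.inl ⟨n, hu₀ _ (par_iterate_ne_self hE hrootless u₀ n) hxy
          (par_iterate_edge hrootless n u₀)⟩
      · exact Or.inr (h.tail hxy)
    · rcases ih with ⟨n, rfl⟩ | h
      · exact Or.inl ⟨n + 1, by
          rw [Function.iterate_succ_apply', par_eq_of_edge hE hrootless hyx]⟩
      · rcases h.cases_tail with rfl | ⟨z, hz, hzx⟩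
        · exact Or.inl ⟨1, (par_eq_of_edge hE hrootless hyx).symm⟩
        · exact Or.inr (hE.2.1 _ _ _ hzx hyx ▸ hz)

theorem reflTransGen_avoiding (hE : IsDirectedTree E) (hrootless : ∀ v : V, ∃ u, E u v)
    {u₀ a v : V} (ha : E u₀ a) (h : Relation.ReflTransGen E a v) :
    Relation.ReflTransGen (fun x y => E x y ∧ x ≠ u₀) a v := by
  induction h with
  | refl => exact .refl
  | tail hx hxy ih =>
    refine ih.tail ⟨hxy, ?_⟩
    rintro rfl
    exact not_reflTransGen_of_edge hE hrootless ha hx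

theorem eq_of_leaf_of_leaf {u₀ a l l' : V} (hu₀ : ∀ u, u ≠ u₀ → {v | E u v}.Subsingleton)
    (hl : ∀ w, ¬ E l w) (hl' : ∀ w, ¬ E l' w)
    (h : Relation.ReflTransGen (fun x y => E x y ∧ x ≠ u₀) a l)
    (h' : Relation.ReflTransGen (fun x y => E x y ∧ x ≠ u₀) a l') : l = l' := by
  have hunique : Relator.RightUnique fun x y => E x y ∧ x ≠ u₀ :=
    fun x _ _ hy hz => hu₀ x hy.2 hy.1 hz.1
  rcases Relation.ReflTransGen.total_of_right_unique hunique h h' with h | h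
  · rcases h.cases_head with h | ⟨c, hc, _⟩
    · exact h
    · exact absurd hc.1 (hl c)
  · rcases h.cases_head with h | ⟨c, hc, _⟩
    · exact h.symm
    · exact absurd hc.1 (hl' c)

theorem exists_leaf_below_children (hE : IsDirectedTree E) (hrootless : ∀ v : V, ∃ u, E u v)
    {u₀ a b : V} (hchildren : {v | E u₀ v} = {a, b})
    (hu₀ : ∀ u, u ≠ u₀ → {v | E u v}.Subsingleton)
    (hleaves : {v : V | ∀ w, ¬ E v w}.ncard = 2) :
    (∃ l, (∀ w, ¬ E l w) ∧ Relation.ReflTransGen (fun x y => E x y ∧ x ≠ u₀) a l) ∧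
      ∃ l, (∀ w, ¬ E l w) ∧ Relation.ReflTransGen (fun x y => E x y ∧ x ≠ u₀) b l := by
  have ha : E u₀ a := (Set.ext_iff.1 hchildren a).2 (by simp)
  have hb : E u₀ b := (Set.ext_iff.1 hchildren b).2 (by simp)
  have hbelow : ∀ l, (∀ w, ¬ E l w) →
      Relation.ReflTransGen (fun x y => E x y ∧ x ≠ u₀) a l ∨
        Relation.ReflTransGen (fun x y => E x y ∧ x ≠ u₀) b l := by
    intro l hl
    rcases par_iterate_or_reflTransGen hE hrootless hu₀ l with ⟨_ | n, rfl⟩ | h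
    · exact absurd ha (hl a)
    · exact absurd (par_iterate_edge hrootless n u₀) (hl _)
    · rcases h.cases_head with rfl | ⟨c, hc, h⟩
      · exact absurd ha (hl a)
      · rcases (Set.ext_iff.1 hchildren c).1 hc with rfl | rfl
        · exact Or.inl (reflTransGen_avoiding hE hrootless ha h)
        · exact Or.inr (reflTransGen_avoiding hE hrootless hb h)
  obtain ⟨l, l', hne, hll'⟩ := Set.ncard_eq_two.1 hleaves
  have hl : ∀ w, ¬ E l w := (Set.ext_iff.1 hll' l).2 (by simp)
  have hl' : ∀ w, ¬ E l' w := (Set.ext_iff.1 hll' l').2 (by simp)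
  rcases hbelow l hl with h | h <;> rcases hbelow l' hl' with h' | h'
  · exact absurd (eq_of_leaf_of_leaf hu₀ hl hl' h h') hne
  · exact ⟨⟨l, hl, h⟩, l', hl', h'⟩
  · exact ⟨⟨l', hl', h'⟩, l, hl, h⟩
  · exact absurd (eq_of_leaf_of_leaf hu₀ hl hl' h h') hne

end Tree

section ShiftOnTree

variable {V : Type*} {E : V → V → Prop} {lam : V → ℝ}
  {S : lp (fun _ : V => ℂ) 2 →L[ℂ] lp (fun _ : V => ℂ) 2}

theorem exists_pow_shift_evec_eq_zero
    (hS : ∀ u v : V, (S (evec u)) v = Set.indicator {w | E u w} (fun w => (lam w : ℂ)) v)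
    {u₀ : V} (hu₀ : ∀ u, u ≠ u₀ → {v | E u v}.Subsingleton) {a l : V} (hl : ∀ w, ¬ E l w)
    (h : Relation.ReflTransGen (fun x y => E x y ∧ x ≠ u₀) a l) :
    ∃ q, (S ^ q) (evec a) = 0 := by
  induction h using Relation.ReflTransGen.head_induction_on with
  | refl => exact ⟨1, by rw [pow_one, shift_evec_of_leaf hS hl]⟩
  | @head x y hxy _ ih =>
    obtain ⟨q, hq⟩ := ih
    refine ⟨q + 1, ?_⟩
    rw [pow_succ, mul_apply_eq_comp,
      shift_evec_of_unique_child hS hxy.1 (hu₀ x hxy.2), map_smul, hq, smul_zero]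

theorem evec_mem_of_reflTransGen
    (hS : ∀ u v : V, (S (evec u)) v = Set.indicator {w | E u w} (fun w => (lam w : ℂ)) v)
    (hlam : ∀ v, 0 < lam v) {u₀ : V} (hu₀ : ∀ u, u ≠ u₀ → {v | E u v}.Subsingleton)
    {M : Submodule ℂ (lp (fun _ : V => ℂ) 2)} (hM : ∀ x ∈ M, S x ∈ M) {a v : V}
    (ha : evec a ∈ M) (h : Relation.ReflTransGen (fun x y => E x y ∧ x ≠ u₀) a v) :
    evec v ∈ M := by
  induction h with
  | refl => exact ha
  | @tail x y _ hxy ih =>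
    have hx := hM _ ih
    rw [shift_evec_of_unique_child hS hxy.1 (hu₀ x hxy.2)] at hx
    exact (M.smul_mem_iff (Complex.ofReal_ne_zero.2 (hlam y).ne')).1 hx

end ShiftOnTree

theorem apply_mem_topologicalClosure_span_orbit {H : Type*} [NormedAddCommGroup H]
    [NormedSpace ℂ H] (T : H →L[ℂ] H) (f : H) :
    ∀ x ∈ (Submodule.span ℂ (Set.range fun n : ℕ => (T ^ n) f)).topologicalClosure,
      T x ∈ (Submodule.span ℂ (Set.range fun n : ℕ => (T ^ n) f)).topologicalClosure := by
  intro x hx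
  refine map_mem_closure T.continuous hx fun y hy => ?_
  induction hy using Submodule.span_induction with
  | mem y hy =>
    obtain ⟨n, rfl⟩ := hy
    refine Submodule.subset_span ⟨n + 1, ?_⟩
    simp only [pow_succ', mul_apply_eq_comp]
  | zero => rw [map_zero]; exact Submodule.zero_mem _
  | add y z _ _ hy hz => rw [map_add]; exact Submodule.add_mem _ hy hz
  | smul c y _ hy => rw [map_smul]; exact Submodule.smul_mem _ c hy

/-- If a directed tree has no root, branching index `1` and exactly two leaves, then every
bounded weighted shift on it (with strictly positive weights) is cyclic. -/
theorem stmt_14 {V : Type*} (E : V → V → Prop) (hE : IsDirectedTree E)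
    (hrootless : ∀ v : V, ∃ u, E u v)
    (hBr : ∃ u₀ : V, {v | E u₀ v}.ncard = 2 ∧ ∀ u, u ≠ u₀ → {v | E u v}.Subsingleton)
    (hleaves : {v : V | ∀ w, ¬ E v w}.ncard = 2)
    (lam : V → ℝ) (hlam : ∀ v, 0 < lam v)
    (S : lp (fun _ : V => ℂ) 2 →L[ℂ] lp (fun _ : V => ℂ) 2)
    (hS : ∀ u v : V, (S (evec u)) v = Set.indicator {w | E u w} (fun w => (lam w : ℂ)) v) :
    ∃ f, IsCyclicVector S f := by
  obtain ⟨u₀, hcard, hu₀⟩ := hBr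
  obtain ⟨a, b, hab, hchildren⟩ := Set.ncard_eq_two.1 hcard
  obtain ⟨⟨l, hl, hal⟩, l', hl', hbl'⟩ :=
    exists_leaf_below_children hE hrootless hchildren hu₀ hleaves
  have ha : E u₀ a := (Set.ext_iff.1 hchildren a).2 (by simp)
  have hb : E u₀ b := (Set.ext_iff.1 hchildren b).2 (by simp)
  obtain ⟨p, hp⟩ := exists_pow_shift_evec_eq_zero hS hu₀ hl hal
  obtain ⟨q, hq⟩ := exists_pow_shift_evec_eq_zero hS hu₀ hl' hbl'
  have hSu₀ := shift_evec_of_two_children hS hab hchildren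
  set c : ℕ → ℂ := fun n => ∏ i ∈ Finset.range n, (lam ((par E)^[i] u₀) : ℂ)⁻¹ with hc
  have hc0 : ∀ n, c n ≠ 0 := fun n => Finset.prod_ne_zero_iff.2 fun i _ =>
    inv_ne_zero (Complex.ofReal_ne_zero.2 (hlam _).ne')
  set x : ℕ → lp (fun _ : V => ℂ) 2 := fun n => c n • evec ((par E)^[n] u₀) with hx
  have hSx : ∀ n, S (x (n + 1)) = x n := by
    intro n
    simp only [hx, hc]
    rw [map_smul, shift_evec_of_unique_child hS (par_iterate_edge hrootless n u₀)
      (hu₀ _ (par_iterate_ne_self hE hrootless u₀ n)), smul_smul, Finset.prod_range_succ,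
      mul_assoc, inv_mul_cancel₀ (Complex.ofReal_ne_zero.2 (hlam _).ne'), mul_one]
  have hpow : ∀ m n, (S ^ m) (x (n + m)) = x n := by
    intro m n
    induction m with
    | zero => rfl
    | succ m ih => rw [pow_succ, mul_apply_eq_comp, ← add_assoc, hSx, ih]
  have hx0 : S ((S ^ (p + q)) (x 0)) = 0 := by
    rw [← mul_apply_eq_comp, ← pow_succ', pow_succ, mul_apply_eq_comp]
    have h : x 0 = evec u₀ := by simp [hx, hc]
    have hpa : (S ^ (p + q)) (evec a) = 0 := by
      rw [add_comm, pow_add, mul_apply_eq_comp, hp, map_zero]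
    have hqb : (S ^ (p + q)) (evec b) = 0 := by
      rw [pow_add, mul_apply_eq_comp, hq, map_zero]
    rw [h, hSu₀, map_add, map_smul, map_smul, hpa, hqb, smul_zero, smul_zero, add_zero]
  obtain ⟨f, hf⟩ := exists_orbit_closedSpan_mem S (e := fun n => (S ^ (p + q)) (x n)) hx0
    (fun n => by
      rw [← mul_apply_eq_comp, ← pow_succ', pow_succ,
        mul_apply_eq_comp, hSx]) hp
  refine ⟨f, ?_⟩
  unfold IsCyclicVector
  have hinv := apply_mem_topologicalClosure_span_orbit S f
  have hclosed := Submodule.isClosed_topologicalClosure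
    (Submodule.span ℂ (Set.range fun n : ℕ => (S ^ n) f))
  have horbit := hf _ hclosed fun n =>
    Submodule.le_topologicalClosure _ (Submodule.subset_span ⟨n, rfl⟩)
  generalize (Submodule.span ℂ (Set.range fun n : ℕ => (S ^ n) f)).topologicalClosure = M
    at hinv hclosed horbit ⊢
  obtain ⟨hxM, haM⟩ := horbit
  have hpar : ∀ n, evec ((par E)^[n] u₀) ∈ M := by
    intro n
    have h := hxM (n + (p + q))
    simp only [hpow] at h
    exact (M.smul_mem_iff (hc0 n)).1 h
  have hbM : evec b ∈ M := by
    have h := hinv _ (hpar 0)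
    rw [Function.iterate_zero_apply, hSu₀] at h
    exact (M.smul_mem_iff (Complex.ofReal_ne_zero.2 (hlam b).ne')).1
      ((M.add_mem_iff_right (M.smul_mem _ haM)).1 h)
  refine eq_top_of_forall_evec_mem M hclosed fun v => ?_
  rcases par_iterate_or_reflTransGen hE hrootless hu₀ v with ⟨n, rfl⟩ | h
  · exact hpar n
  · rcases h.cases_head with rfl | ⟨d, hd, h⟩
    · exact hpar 0
    · rcases (Set.ext_iff.1 hchildren d).1 hd with rfl | rfl
      · exact evec_mem_of_reflTransGen hS hlam hu₀ hinv haM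
          (reflTransGen_avoiding hE hrootless ha h)
      · exact evec_mem_of_reflTransGen hS hlam hu₀ hinv hbM
          (reflTransGen_avoiding hE hrootless hb h)
end
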